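/- Let f : A → A be a covering map of degree d with |d| > 1. If there exists a continuum K ⊆ A with f(K) ⊆ K, then f has a periodic point: there exist x ∈ A and an integer n ≥ 1 with fⁿ(x) = x. -/

import Mathlib

open Set Filter Topology

noncomputable section

/-- The open annulus `A = S¹ × (0,1)`. -/
abbrev Ann : Type := Circle × (Set.Ioo (0:ℝ) 1)

/-- The universal cover `Ã = ℝ × (0,1)`. -/
abbrev AnnTil : Type := ℝ × (Set.Ioo (0:ℝ) 1)

/-- The covering projection `π(x,y) = (exp(2πix), y)`. -/
def pr : AnnTil → Ann := fun z => (Circle.exp (2 * Real.pi * z.1), z.2)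

/-- Translation by an integer in the first coordinate: `z + k`. -/
def tr (z : AnnTil) (k : ℤ) : AnnTil := (z.1 + k, z.2)

/-- `F` is a lift of `f`. -/
def IsLift (f : Ann → Ann) (F : AnnTil → AnnTil) : Prop :=
  Continuous F ∧ pr ∘ F = f ∘ pr

/-- `f` has degree `d`: some lift satisfies `F(z+1) = F(z) + d`. -/
def HasDegree (f : Ann → Ann) (d : ℤ) : Prop :=
  ∃ F : AnnTil → AnnTil, IsLift f F ∧ ∀ z, F (tr z 1) = tr (F z) d

/-- A subset of the annulus is essential if it is not contained in any
connected, simply connected open subset. -/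
def IsEssential (K : Set Ann) : Prop :=
  ¬ ∃ U : Set Ann, IsOpen U ∧ IsConnected U ∧ SimplyConnectedSpace U ∧ K ⊆ U

/-- Nielsen equivalence of fixed points `p`, `q` of `g`: there is a path `γ`
from `p` to `q` homotopic (rel endpoints) to `g ∘ γ`. -/
def NielsenEquiv (g : Ann → Ann) (p q : Ann) : Prop :=
  ∃ (hg : Continuous g) (hp : g p = p) (hq : g q = q) (γ : Path p q),
    γ.Homotopic ((γ.map hg).cast hp.symm hq.symm)

/-- `g` has exactly `N` Nielsen classes of fixed points. -/
def HasExactlyNielsenClasses (g : Ann → Ann) (N : ℕ) : Prop :=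
  ∃ S : Finset Ann, S.card = N ∧ (∀ p ∈ S, g p = p) ∧
    (∀ p ∈ S, ∀ q ∈ S, p ≠ q → ¬ NielsenEquiv g p q) ∧
    (∀ p, g p = p → ∃ q ∈ S, NielsenEquiv g p q)

/-- `Fill K`: the union of `K` with the connected components of its
complement whose closure is compact. -/
def Fill (K : Set Ann) : Set Ann :=
  K ∪ {x | x ∈ Kᶜ ∧ IsCompact (closure (connectedComponentIn Kᶜ x))}


/-- continuous logarithms of a function on an open convex set. -/
lemma bw_log {E : Type*} [NormedAddCommGroup E] [NormedSpace ℝ E] {U : Set E} (hU : IsOpen U)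
    (hc : Convex ℝ U) (hne : U.Nonempty) {g : E → ℂ} (hg : ContinuousOn g U)
    (h0 : ∀ x ∈ U, g x ≠ 0) :
    ∃ L : E → ℂ, ContinuousOn L U ∧ ∀ x ∈ U, Complex.exp (L x) = g x := by
  have : ContractibleSpace U := hc.contractibleSpace hne
  have h1 : IsSimplyConnected U := by
    unfold IsSimplyConnected; infer_instance
  obtain ⟨f, hf, hf2⟩ := Complex.exists_continuousOn_eqOn_exp_comp h1 hU hg
    (by rintro ⟨x, hx, hx0⟩; exact h0 x hx hx0)
  exact ⟨f, hf, fun x hx => hf2 hx⟩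

lemma bw_log_univ {E : Type*} [NormedAddCommGroup E] [NormedSpace ℝ E] {g : E → ℂ}
    (hg : Continuous g) (h0 : ∀ x, g x ≠ 0) :
    ∃ L : E → ℂ, Continuous L ∧ ∀ x, Complex.exp (L x) = g x := by
  obtain ⟨L, h1, h2⟩ := bw_log (U := (univ : Set E)) isOpen_univ convex_univ ⟨0, trivial⟩
    hg.continuousOn (fun x _ => h0 x)
  exact ⟨L, continuousOn_univ.1 h1, fun x => h2 x trivial⟩

/-- two continuous logarithms on a preconnected set differ by a constant. -/
lemma bw_const {X : Type*} [TopologicalSpace X] {U : Set X} (hU : IsPreconnected U)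
    {L : X → ℂ} (c : ℂ) (hL : ContinuousOn L U) (h : ∀ x ∈ U, Complex.exp (L x) = c) :
    ∀ x ∈ U, ∀ y ∈ U, L x = L y := by
  intro x hx y hy
  have := Complex.isCoveringMap_exp
  have hh : EqOn L (fun _ => L y) U := by
    refine this.eqOn_of_comp_eqOn hU hL continuousOn_const ?_ hy rfl
    intro z hz
    simp [h z hz, h y hy]
  exact hh hx

/-- Orientation preserving. -/
def BwOP (G : ℂ → ℂ) : Prop :=
  ∃ L : ℂ × ℂ → ℂ, ContinuousOn L {p | p.1 ≠ p.2} ∧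
    ∀ z w, z ≠ w → Complex.exp (L (z, w)) = (G w - G z) / (w - z)

lemma BwOP.comp {G H : ℂ → ℂ} (hG : BwOP G) (hH : BwOP H) (hi : Function.Injective H)
    (hc : Continuous H) : BwOP (G ∘ H) := by
  obtain ⟨L, hL, hL2⟩ := hG
  obtain ⟨M, hM, hM2⟩ := hH
  refine ⟨fun p => L (H p.1, H p.2) + M p, ?_, ?_⟩
  · refine ContinuousOn.add (hL.comp (Continuous.continuousOn (by fun_prop)) ?_) hM
    intro p hp h
    exact hp (hi h)
  · intro z w hzw
    have h1 : H w - H z ≠ 0 := fun h => hzw (hi (sub_eq_zero.1 h)).symm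
    have h2 : w - z ≠ 0 := fun h => hzw (sub_eq_zero.1 h).symm
    rw [Complex.exp_add, hL2 _ _ (fun h => hzw (hi h)), hM2 _ _ hzw]
    simp only [Function.comp]
    field_simp

lemma BwOP.symm {G : ℂ ≃ₜ ℂ} (hG : BwOP G) : BwOP G.symm := by
  obtain ⟨L, hL, hL2⟩ := hG
  refine ⟨fun p => - L (G.symm p.1, G.symm p.2), ?_, ?_⟩
  · refine ContinuousOn.neg (hL.comp (Continuous.continuousOn (by fun_prop)) ?_)
    intro p hp h
    exact hp (G.symm.injective h)
  · intro z w hzw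
    rw [Complex.exp_neg, hL2 _ _ (fun h => hzw (G.symm.injective h))]
    simp

lemma bw_exp_eq_one_of {a : ℂ} (h : 2 * a = 0) (h2 : Complex.exp a = -1) : False := by
  have : a = 0 := by simpa using h
  subst this
  norm_num at h2

lemma bw_offdiag_preconn : IsPreconnected {p : ℂ × ℂ | p.1 ≠ p.2} := by
  have h : {p : ℂ × ℂ | p.1 ≠ p.2} = (fun p : ℂ × ℂ => (p.1, p.1 + Complex.exp p.2)) '' univ := by
    ext ⟨z, w⟩
    simp only [mem_ofPred_eq, image_univ, mem_range, Prod.mk.injEq, Prod.exists]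
    constructor
    · intro h
      refine ⟨z, Complex.log (w - z), rfl, ?_⟩
      rw [Complex.exp_log (sub_ne_zero.2 (Ne.symm h))]; ring
    · rintro ⟨a, b, rfl, rfl⟩ h
      exact Complex.exp_ne_zero b (by simpa using h)
  rw [h]
  exact isPreconnected_univ.image _ (Continuous.continuousOn (by fun_prop))

/-- A symmetric version of the logarithm. -/
lemma BwOP.exists_symm {G : ℂ → ℂ} (hG : BwOP G) :
  ∃ L : ℂ × ℂ → ℂ, ContinuousOn L {p | p.1 ≠ p.2} ∧
    (∀ z w, z ≠ w → Complex.exp (L (z, w)) = (G w - G z) / (w - z)) ∧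
    ∀ z w, z ≠ w → L (z, w) = L (w, z) := by
  obtain ⟨L, hL, hL2⟩ := hG
  refine ⟨L, hL, hL2, ?_⟩
  have hc : ContinuousOn (fun p : ℂ × ℂ => L p - L (p.2, p.1)) {p | p.1 ≠ p.2} := by
    refine hL.sub (hL.comp (Continuous.continuousOn (by fun_prop)) ?_)
    intro p hp h
    exact hp h.symm
  have := bw_const bw_offdiag_preconn 1 hc (by
    rintro ⟨z, w⟩ h
    simp only [mem_ofPred_eq] at h
    have h1 : w - z ≠ 0 := sub_ne_zero.2 (Ne.symm h)
    have h3 : Complex.exp (L (z, w)) ≠ 0 := Complex.exp_ne_zero _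
    have h4 : L (z, w) - L (w, z) = L (z,w) - L (w,z) := rfl
    have h5 : Complex.exp (L (z, w)) = Complex.exp (L (w, z)) := by
      rw [hL2 _ _ h, hL2 _ _ (Ne.symm h), ← neg_sub (G w), ← neg_sub w, neg_div_neg_eq]
    simp only
    rw [Complex.exp_sub, ← h5, div_self h3])
  intro z w h
  have h1 := this (z, w) h (w, z) (Ne.symm h)
  simp only at h1
  have h2 : 2 * (L (z, w) - L (w, z)) = 0 := by linear_combination h1
  have h3 : L (z, w) - L (w, z) = 0 := by simpa using h2
  linear_combination h3

/-- No points of period two. -/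
lemma bw_no_two {G : ℂ → ℂ} (hG : BwOP G) (hc : Continuous G) (hf : ∀ z, G z ≠ z)
    (x : ℂ) : G (G x) ≠ x := by
  intro hx
  obtain ⟨L, hL, hL2, hs⟩ := hG.exists_symm
  obtain ⟨V, hV, hV2⟩ := bw_log_univ (g := fun z => G z - z) (by fun_prop)
    (fun z => sub_ne_zero.2 (hf z))
  have hcc : ContinuousOn (fun z => L (z, G z) - (V (G z) - V z)) univ := by
    refine ContinuousOn.sub (hL.comp (Continuous.continuousOn (by fun_prop)) ?_)
      (Continuous.continuousOn (by fun_prop))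
    intro z _ h
    exact hf z h.symm
  have := bw_const isPreconnected_univ 1 hcc (by
    intro z _
    have h1 : G z - z ≠ 0 := sub_ne_zero.2 (hf z)
    have h2 : G (G z) - G z ≠ 0 := sub_ne_zero.2 (hf _)
    rw [Complex.exp_sub, Complex.exp_sub, hL2 _ _ (hf z).symm, hV2, hV2]
    field_simp) x trivial (G x) trivial
  simp only [hx] at this
  rw [hs _ _ (hf x).symm] at this
  refine bw_exp_eq_one_of (a := V (G x) - V x) (by linear_combination -this) ?_
  rw [Complex.exp_sub, hV2, hV2, hx, ← neg_sub, neg_div, div_self (sub_ne_zero.2 (hf x))]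

/-- The core argument: a translation curve cannot self-intersect. -/
lemma bw_core {G : ℂ → ℂ} (hG : BwOP G) (hc : Continuous G) (hf : ∀ z, G z ≠ z)
    {γ : ℝ → ℂ} (hγ : Continuous γ) (hγ1 : ∀ t, γ (t + 1) = G (γ t))
    {s t : ℝ} (hst : s + 1 < t) (he : γ s = γ t)
    (hmin : ∀ u v, u < v → v - u < t - s → γ u ≠ γ v) : False := by
  obtain ⟨L, hL, hL2, hs⟩ := hG.exists_symm
  obtain ⟨V, hV, hV2⟩ := bw_log_univ (g := fun z => G z - z) (by fun_prop)
    (fun z => sub_ne_zero.2 (hf z))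
  set S : Set (ℝ × ℝ) := {p | p.1 < p.2 ∧ p.2 - p.1 < t - s} with hS
  have hSo : IsOpen S := by
    exact (isOpen_lt continuous_fst continuous_snd).inter
      (isOpen_lt (f := fun p : ℝ × ℝ => p.2 - p.1) (g := fun _ => t - s) (by fun_prop)
        continuous_const)
  have hSc : Convex ℝ S := by
    rintro ⟨a, b⟩ ⟨h1, h2⟩ ⟨c, d⟩ ⟨h3, h4⟩ x y hx hy hxy
    simp only at h1 h2 h3 h4
    obtain rfl : y = 1 - x := by linarith
    simp only [hS, mem_ofPred_eq, Prod.fst_add, Prod.snd_add, Prod.smul_fst, Prod.smul_snd,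
      smul_eq_mul]
    rcases hx.eq_or_lt with rfl | hx
    · constructor <;> linarith
    · constructor <;> nlinarith
  have hSn : S.Nonempty := ⟨(s, s + 1), by simp, by simp only; linarith⟩
  obtain ⟨Λ, hΛ, hΛ2⟩ := bw_log (g := fun p : ℝ × ℝ => γ p.2 - γ p.1) hSo hSc hSn
    (Continuous.continuousOn (by fun_prop))
    (fun p hp => sub_ne_zero.2 (hmin _ _ hp.1 hp.2).symm)
  have hne : ∀ p ∈ S, γ p.1 ≠ γ p.2 := fun p hp => hmin _ _ hp.1 hp.2
  have hsh : ∀ p ∈ S, (p.1 + 1, p.2 + 1) ∈ S := by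
    intro p hp
    exact ⟨by simpa using hp.1, by simpa using hp.2⟩
  -- first: index zero
  have hA : Λ (t, t + 1) = Λ (s, s + 1) := by
    have hcc : ContinuousOn (fun u : ℝ => Λ (u, u + 1) - V (γ u)) univ := by
      refine ContinuousOn.sub (hΛ.comp (Continuous.continuousOn (by fun_prop)) ?_)
        (Continuous.continuousOn (by fun_prop))
      intro u _
      exact ⟨by simp, by simp only; linarith⟩
    have := bw_const isPreconnected_univ 1 hcc (by
      intro u _
      rw [Complex.exp_sub, hΛ2 _ ⟨by simp, by simp only; linarith⟩, hV2]
      simp only [hγ1]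
      exact div_self (sub_ne_zero.2 (hf _))) t trivial s trivial
    simp only [he] at this
    linear_combination this
  -- second: equivariance
  have hB : ∀ p ∈ S, ∀ q ∈ S, Λ (p.1 + 1, p.2 + 1) - Λ p - L (γ p.1, γ p.2) =
      Λ (q.1 + 1, q.2 + 1) - Λ q - L (γ q.1, γ q.2) := by
    have hcc : ContinuousOn (fun p : ℝ × ℝ => Λ (p.1 + 1, p.2 + 1) - Λ p - L (γ p.1, γ p.2)) S := by
      refine ContinuousOn.sub (ContinuousOn.sub
        (hΛ.comp (Continuous.continuousOn (by fun_prop)) hsh) hΛ)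
        (hL.comp (Continuous.continuousOn (by fun_prop)) hne)
    refine bw_const hSc.isPreconnected 1 hcc ?_
    intro p hp
    have h1 := sub_ne_zero.2 (hne p hp).symm
    have h2 := sub_ne_zero.2 (hne _ (hsh p hp)).symm
    simp only [hγ1] at h2
    rw [Complex.exp_sub, Complex.exp_sub, hL2 _ _ (hne p hp), hΛ2 _ hp, hΛ2 _ (hsh p hp)]
    simp only [hγ1]
    field_simp
  -- third
  have hE : ∀ k, γ k = γ (k + (t - s)) → ∀ m ∈ Ioo k (k + (t - s)), ∀ m' ∈ Ioo k (k + (t - s)),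
      Λ (m, k + (t - s)) - Λ (k, m) = Λ (m', k + (t - s)) - Λ (k, m') := by
    intro k hk
    have hcc : ContinuousOn (fun m => Λ (m, k + (t - s)) - Λ (k, m)) (Ioo k (k + (t - s))) := by
      refine ContinuousOn.sub (hΛ.comp (Continuous.continuousOn (by fun_prop)) ?_)
        (hΛ.comp (Continuous.continuousOn (by fun_prop)) ?_)
      · intro m hm
        exact ⟨hm.2, by have := hm.1; simp only; linarith⟩
      · intro m hm
        exact ⟨hm.1, by have := hm.2; simp only; linarith⟩
    refine bw_const isPreconnected_Ioo (-1) hcc ?_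
    intro m hm
    have h1 : (m, k + (t - s)) ∈ S := ⟨hm.2, by have := hm.1; simp only; linarith⟩
    have h2 : (k, m) ∈ S := ⟨hm.1, by have := hm.2; simp only; linarith⟩
    have h3 := sub_ne_zero.2 (hne _ h2).symm
    rw [Complex.exp_sub, hΛ2 _ h1, hΛ2 _ h2]
    simp only at h3 ⊢
    rw [← hk, ← neg_sub (γ m), neg_div, div_self h3]
  have e1 : s + (t - s) = t := by ring
  have e2 : s + 1 + (t - s) = t + 1 := by ring
  have h1 : (s, s + 1) ∈ S := ⟨by simp, by simp only; linarith⟩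
  have h2 : (s + 1, t) ∈ S := ⟨hst, by simp only; linarith⟩
  have hE1 := hE (s + 1) (by rw [e2, hγ1, hγ1, he]) (s + 1 + 1)
    ⟨by linarith, by linarith⟩ t ⟨by linarith, by linarith⟩
  rw [e2] at hE1
  have hB1 := hB _ h2 _ h1
  simp only at hB1
  have hsy := hs (γ s) (γ (s + 1)) (hne _ h1)
  rw [← he, ← hsy] at hB1
  refine bw_exp_eq_one_of (a := Λ (s + 1, t) - Λ (s, s + 1)) ?_ ?_
  · linear_combination hA + hE1 - hB1
  · have h3 := sub_ne_zero.2 (hne _ h1).symm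
    rw [Complex.exp_sub, hΛ2 _ h1, hΛ2 _ h2]
    simp only at h3 ⊢
    rw [← he, ← neg_sub (γ (s + 1)), neg_div, div_self h3]


lemma bw_arc (G : ℂ ≃ₜ ℂ) (hf : ∀ z, G z ≠ z) (hf2 : ∀ z, G (G z) ≠ z) (x : ℂ) :
    ∃ γ : ℝ → ℂ, Continuous γ ∧ (∀ t, γ (t + 1) = G (γ t)) ∧ γ (1 / 2) = x ∧
      ∀ u v, u < v → v - u ≤ 1 → γ u ≠ γ v := by
  have hGc := G.continuous
  obtain ⟨y, hy⟩ : ∃ y, ∀ z, max ‖y - x‖ ‖G y - x‖ ≤ max ‖z - x‖ ‖G z - x‖ := by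
    refine Continuous.exists_forall_le' (f := fun z => max ‖z - x‖ ‖G z - x‖) (by fun_prop) x ?_
    filter_upwards [(isCompact_closedBall x (max ‖x - x‖ ‖G x - x‖)).compl_mem_cocompact] with z hz
    simp only [mem_compl_iff, Metric.mem_closedBall, not_le, dist_eq_norm] at hz
    exact hz.le.trans (le_max_left _ _)
  set r := max ‖y - x‖ ‖G y - x‖ with hr
  have hr0 : 0 < r := by
    by_contra h
    have h1 : ‖y - x‖ ≤ 0 := (le_max_left _ _).trans (not_lt.1 h)
    have h2 : ‖G y - x‖ ≤ 0 := (le_max_right _ _).trans (not_lt.1 h)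
    have h1' := sub_eq_zero.1 (norm_le_zero_iff.1 h1)
    have h2' := sub_eq_zero.1 (norm_le_zero_iff.1 h2)
    exact hf y (by rw [h2', h1'])
  have hno : ∀ q, ‖q - x‖ < r → ‖G q - x‖ < r → False := by
    intro q h1 h2
    exact absurd (hy q) (not_le.2 (max_lt h1 h2))
  have hcl : ∀ q, ‖q - x‖ ≤ r → q ∈ closure (Metric.ball x r) := by
    intro q hq
    rw [closure_ball x hr0.ne']
    simpa [dist_eq_norm] using hq
  have hkey : ∀ p, ‖p - x‖ ≤ r → ‖G p - x‖ ≤ r → ‖p - x‖ = r ∧ ‖G p - x‖ = r := by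
    intro p h1 h2
    constructor
    · refine le_antisymm h1 (not_lt.1 fun h => ?_)
      have ho : IsOpen (G '' Metric.ball x r) := G.isOpenMap _ Metric.isOpen_ball
      obtain ⟨_, ⟨q, hq, rfl⟩, hq2⟩ := mem_closure_iff.1 (hcl _ h2) _ ho
        ⟨p, by simpa [dist_eq_norm] using h, rfl⟩
      exact hno q (by simpa [dist_eq_norm] using hq) (by simpa [dist_eq_norm] using hq2)
    · refine le_antisymm h2 (not_lt.1 fun h => ?_)
      have ho : IsOpen (G ⁻¹' Metric.ball x r) := Metric.isOpen_ball.preimage hGc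
      obtain ⟨q, hq, hq2⟩ := mem_closure_iff.1 (hcl _ h1) _ ho
        (by simpa [dist_eq_norm] using h)
      exact hno q (by simpa [dist_eq_norm] using hq2) (by simpa [dist_eq_norm] using hq)
  obtain ⟨hy1, hy2⟩ := hkey y (le_max_left _ _) (le_max_right _ _)
  set α : ℝ → ℂ := fun t => x + (max (1 - 2 * t) 0 : ℝ) • (y - x) +
    (max (2 * t - 1) 0 : ℝ) • (G y - x) with hα
  have hαc : Continuous α := by fun_prop
  have hα0 : α 0 = y := by simp [hα]
  have hα1 : α 1 = G y := by
    simp only [hα]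
    norm_num
  have hαh : α (1 / 2) = x := by simp [hα]
  have hα_l : ∀ t, t ≤ 1 / 2 → α t = x + (1 - 2 * t) • (y - x) := by
    intro t ht
    simp only [hα]
    rw [max_eq_left (by linarith), max_eq_right (by linarith)]
    simp
  have hα_r : ∀ t, 1 / 2 ≤ t → α t = x + (2 * t - 1) • (G y - x) := by
    intro t ht
    simp only [hα]
    rw [max_eq_right (by linarith), max_eq_left (by linarith)]
    simp
  have hn_l : ∀ t, t ≤ 1 / 2 → ‖α t - x‖ = (1 - 2 * t) * r := by
    intro t ht
    rw [hα_l t ht, add_sub_cancel_left, norm_smul, hy1, Real.norm_eq_abs,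
      abs_of_nonneg (by linarith)]
  have hn_r : ∀ t, 1 / 2 ≤ t → ‖α t - x‖ = (2 * t - 1) * r := by
    intro t ht
    rw [hα_r t ht, add_sub_cancel_left, norm_smul, hy2, Real.norm_eq_abs,
      abs_of_nonneg (by linarith)]
  have hne : ∀ t t', t < 1 / 2 → 1 / 2 ≤ t' → α t ≠ α t' := by
    intro t t' h1 h2 h
    have e := hn_l t h1.le
    rw [h, hn_r t' h2] at e
    have e2 := mul_right_cancel₀ hr0.ne' e
    rw [hα_l t h1.le, hα_r t' h2, e2] at h
    have h3 := add_left_cancel h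
    have h4 := smul_right_injective ℂ (show (1 - 2 * t) ≠ 0 by linarith) h3
    exact hf y (sub_left_injective h4).symm
  have hinj : ∀ t t', α t = α t' → t = t' := by
    intro t t' h
    rcases lt_or_ge t (1 / 2) with h1 | h1 <;> rcases lt_or_ge t' (1 / 2) with h2 | h2
    · have e := hn_l t h1.le
      rw [h, hn_l t' h2.le] at e
      have := mul_right_cancel₀ hr0.ne' e
      linarith
    · exact absurd h (hne t t' h1 h2)
    · exact absurd h.symm (hne t' t h2 h1)
    · have e := hn_r t h1
      rw [h, hn_r t' h2] at e
      have := mul_right_cancel₀ hr0.ne' e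
      linarith
  have hle : ∀ t ∈ Icc (0:ℝ) 1, ‖α t - x‖ ≤ r ∧ (‖α t - x‖ = r → t = 0 ∨ t = 1) := by
    intro t ht
    rcases le_total t (1 / 2) with h | h
    · rw [hn_l t h]
      refine ⟨by nlinarith [ht.1], fun h2 => Or.inl ?_⟩
      have : (1 - 2 * t) * r = 1 * r := by linarith
      have := mul_right_cancel₀ hr0.ne' this
      linarith
    · rw [hn_r t h]
      refine ⟨by nlinarith [ht.2], fun h2 => Or.inr ?_⟩
      have : (2 * t - 1) * r = 1 * r := by linarith
      have := mul_right_cancel₀ hr0.ne' this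
      linarith
  have hcross : ∀ t ∈ Icc (0:ℝ) 1, ∀ t' ∈ Icc (0:ℝ) 1, α t = G (α t') → t = 1 := by
    intro t ht t' ht' h
    obtain ⟨h1, h2⟩ := hkey (α t') (hle t' ht').1 (by rw [← h]; exact (hle t ht).1)
    rw [← h] at h2
    rcases (hle t ht).2 h2 with rfl | rfl
    · exfalso
      rcases (hle t' ht').2 h1 with rfl | rfl
      · rw [hα0] at h; exact hf y h.symm
      · rw [hα0, hα1] at h; exact hf2 y h.symm
    · rfl
  -- the curve
  set γ : ℝ → ℂ := fun t => (G ^ ⌊t⌋ : ℂ ≃ₜ ℂ) (α (Int.fract t)) with hγ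
  have hγk : ∀ (k : ℤ) (t : ℝ), γ (t + k) = (G ^ k : ℂ ≃ₜ ℂ) (γ t) := by
    intro k t
    simp only [hγ, Int.floor_add_intCast, Int.fract_add_intCast, add_comm _ k, zpow_add]
    rfl
  have hγ1 : ∀ t, γ (t + 1) = G (γ t) := by
    intro t
    have := hγk 1 t
    simpa using this
  set δ : ℝ → ℂ := fun t => if t ≤ 1 then α t else G (α (t - 1)) with hδ
  have hδc : Continuous δ := by
    refine Continuous.if_le hαc (by fun_prop) continuous_id continuous_const ?_
    rintro t rfl
    simp [hα0, hα1]
  have hγδ : ∀ t ∈ Ico (0:ℝ) 2, γ t = δ t := by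
    intro t ht
    rcases lt_or_ge t 1 with h | h
    · have h1 : ⌊t⌋ = 0 := Int.floor_eq_zero_iff.2 ⟨ht.1, h⟩
      have h2 : Int.fract t = t := Int.fract_eq_self.2 ⟨ht.1, h⟩
      simp only [hγ, hδ, h1, h2, if_pos h.le]
      simp
    · have h1 : γ t = G (α (t - 1)) := by
        have e : t = (t - 1) + 1 := by ring
        have h3 : ⌊t - 1⌋ = 0 := Int.floor_eq_zero_iff.2 ⟨by linarith, by linarith [ht.2]⟩
        have h2 : Int.fract (t - 1) = t - 1 :=
          Int.fract_eq_self.2 ⟨by linarith, by linarith [ht.2]⟩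
        conv_lhs => rw [e]
        rw [hγ1]
        simp only [hγ, h3, h2]
        simp
      rw [h1]
      simp only [hδ]
      split_ifs with h2
      · have : t = 1 := le_antisymm h2 h
        subst this
        simp [hα0, hα1]
      · rfl
  have hγc : Continuous γ := by
    rw [continuous_iff_continuousAt]
    intro t
    set k : ℤ := ⌊t⌋ - 1 with hk
    have e : γ = fun u => (G ^ k : ℂ ≃ₜ ℂ) (γ (u - k)) := by
      funext u
      rw [← hγk k (u - k)]
      simp
    have h1 : ContinuousAt γ (t - k) := by
      have : γ =ᶠ[𝓝 (t - k)] δ := by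
        have hm : Ioo (0:ℝ) 2 ∈ 𝓝 (t - k) := by
          refine Ioo_mem_nhds ?_ ?_
          · have := Int.floor_le t
            simp only [hk]; push_cast; linarith
          · have := Int.lt_floor_add_one t
            simp only [hk]; push_cast; linarith
        filter_upwards [hm] with u hu
        exact hγδ u ⟨hu.1.le, hu.2⟩
      exact hδc.continuousAt.congr this.symm
    rw [e]
    refine (G ^ k : ℂ ≃ₜ ℂ).continuous.continuousAt.comp ?_
    exact ContinuousAt.comp (f := fun u : ℝ => u - k) h1 (by fun_prop)
  refine ⟨γ, hγc, hγ1, ?_, ?_⟩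
  · rw [hγδ _ (by norm_num)]
    simp only [hδ]
    rw [if_pos (by norm_num), hαh]
  · intro u v huv huv1 h
    set k : ℤ := ⌊u⌋ with hk
    have h0 : 0 ≤ u - k := by have := Int.floor_le u; linarith
    have h0' : u - k < 1 := by have := Int.lt_floor_add_one u; linarith
    have h1 : γ (u - k) = γ (v - k) := by
      apply (G ^ k : ℂ ≃ₜ ℂ).injective
      rw [← hγk, ← hγk]
      simpa using h
    rw [hγδ _ ⟨h0, by linarith⟩, hγδ _ ⟨by linarith, by linarith⟩] at h1
    simp only [hδ] at h1
    rw [if_pos h0'.le] at h1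
    split_ifs at h1 with h2
    · have := hinj _ _ h1
      linarith
    · have := hcross _ ⟨h0, h0'.le⟩ _ ⟨by linarith, by linarith⟩ h1
      linarith

/-- A fixed point free orientation preserving plane homeomorphism has no periodic point. -/
lemma bw_no_periodic (G : ℂ ≃ₜ ℂ) (hG : BwOP G) (hf : ∀ z, G z ≠ z) (x : ℂ) (n : ℕ)
    (hn : 1 ≤ n) (hx : G^[n] x = x) : False := by
  obtain ⟨γ, hγ, hγ1, hγx, hinj⟩ := bw_arc G hf (bw_no_two hG G.continuous hf) x
  have hγn : ∀ (n : ℕ) t, γ (t + n) = G^[n] (γ t) := by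
    intro n
    induction n with
    | zero => simp
    | succ k ih =>
      intro t
      rw [Function.iterate_succ_apply', ← ih, ← hγ1]
      push_cast
      ring_nf
  have hn' : (1:ℝ) ≤ n := by exact_mod_cast hn
  set P : Set (ℝ × ℝ) := (Icc (0:ℝ) 1 ×ˢ Icc (0:ℝ) (n + 1)) ∩
    ({p | 1 ≤ p.2 - p.1} ∩ ({p | p.2 - p.1 ≤ n} ∩ {p | γ p.1 = γ p.2})) with hP
  have hPc : IsCompact P := by
    refine (isCompact_Icc.prod isCompact_Icc).inter_right ?_
    refine (isClosed_le (f := fun _ => (1:ℝ)) (g := fun p : ℝ × ℝ => p.2 - p.1)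
      (by fun_prop) (by fun_prop)).inter ?_
    refine (isClosed_le (g := fun _ => (n:ℝ)) (f := fun p : ℝ × ℝ => p.2 - p.1)
      (by fun_prop) (by fun_prop)).inter ?_
    exact isClosed_eq (f := fun p : ℝ × ℝ => γ p.1) (g := fun p : ℝ × ℝ => γ p.2)
      (by fun_prop) (by fun_prop)
  have hPn : P.Nonempty := by
    refine ⟨(1 / 2, 1 / 2 + n), ⟨⟨by norm_num, by norm_num⟩, ?_, ?_⟩, ?_, ?_, ?_⟩
    · simp only; linarith
    · simp only; linarith
    · change (1:ℝ) ≤ 1 / 2 + n - 1 / 2; linarith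
    · change 1 / 2 + (n:ℝ) - 1 / 2 ≤ n; linarith
    · change γ (1 / 2) = γ (1 / 2 + n)
      rw [hγn, hγx, hx]
  obtain ⟨⟨s, t⟩, ⟨-, hst1, hst2, hst3⟩, hm⟩ := hPc.exists_isMinOn hPn
    (f := fun p : ℝ × ℝ => p.2 - p.1) (Continuous.continuousOn (by fun_prop))
  change 1 ≤ t - s at hst1
  change t - s ≤ n at hst2
  change γ s = γ t at hst3
  refine bw_core hG G.continuous hf hγ hγ1 (s := s) (t := t) ?_ hst3 ?_
  · rcases hst1.eq_or_lt with h | h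
    · exfalso
      have : t = s + 1 := by linarith
      rw [this, hγ1] at hst3
      exact hf _ hst3.symm
    · linarith
  · intro u v huv huv2 h
    rcases le_or_gt (v - u) 1 with h1 | h1
    · exact hinj u v huv h1 h
    · set k : ℤ := ⌊u⌋ with hk
      have h0 : 0 ≤ u - k := by have := Int.floor_le u; linarith
      have h0' : u - k < 1 := by have := Int.lt_floor_add_one u; linarith
      have hshift : ∀ (k : ℤ) a, γ (a + k) = (G ^ k : ℂ ≃ₜ ℂ) (γ a) := by
        intro k
        induction k with
        | zero => simp
        | succ i ih =>
          intro a
          have : a + ((i + 1 : ℤ) : ℝ) = (a + (i : ℤ)) + 1 := by push_cast; ring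
          rw [this, hγ1, ih, add_comm, zpow_add, zpow_one]
          rfl
        | pred i ih =>
          intro a
          have e : a + ((-(i:ℤ) - 1 : ℤ) : ℝ) + 1 = a + ((-(i:ℤ) : ℤ) : ℝ) := by push_cast; ring
          apply G.injective
          rw [← hγ1, e, ih]
          have : (G ^ (-(i:ℤ)) : ℂ ≃ₜ ℂ) = G * G ^ (-(i:ℤ) - 1) := by
            rw [← zpow_one_add]; congr 1; ring
          rw [this]; rfl
      have h2 : γ (u - k) = γ (v - k) := by
        apply (G ^ k : ℂ ≃ₜ ℂ).injective
        rw [← hshift, ← hshift]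
        simpa using h
      have := hm (show (u - k, v - k) ∈ P from ⟨⟨⟨h0, h0'.le⟩, by simp only; linarith,
        by simp only; linarith⟩, by change (1:ℝ) ≤ v - k - (u - k); linarith,
        by change v - k - (u - k) ≤ (n:ℝ); linarith, h2⟩)
      change t - s ≤ v - k - (u - k) at this
      linarith


lemma bw_lift (G : ℂ ≃ₜ ℂ) : ∃ (g : ℂ × ℂ → ℂ) (k : ℤ), Continuous g ∧
    (∀ z ζ, Complex.exp (g (z, ζ)) = G (z + Complex.exp ζ) - G z) ∧
    ∀ z ζ (j : ℤ), g (z, ζ + j * (2 * Real.pi * Complex.I)) =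
      g (z, ζ) + j * (k * (2 * Real.pi * Complex.I)) := by
  have hc := G.continuous
  obtain ⟨g, hg, hg2⟩ := bw_log_univ (g := fun p : ℂ × ℂ => G (p.1 + Complex.exp p.2) - G p.1)
    (by fun_prop) (by
      intro p h
      have := G.injective (sub_eq_zero.1 h)
      exact Complex.exp_ne_zero p.2 (by simpa using this))
  have hcc : Continuous (fun p : ℂ × ℂ => g (p.1, p.2 + 2 * Real.pi * Complex.I) - g p) := by
    fun_prop
  have h1 : ∀ p : ℂ × ℂ, Complex.exp (g (p.1, p.2 + 2 * Real.pi * Complex.I) - g p) = 1 := by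
    intro p
    rw [Complex.exp_sub, hg2, hg2]
    simp only [Complex.exp_add, Complex.exp_two_pi_mul_I, mul_one]
    rw [← hg2 p, div_self (Complex.exp_ne_zero _)]
  have h2 := bw_const isPreconnected_univ 1 hcc.continuousOn (fun p _ => h1 p)
  obtain ⟨k, hk⟩ := Complex.exp_eq_one_iff.1 (h1 (0, 0))
  have h3 : ∀ z ζ, g (z, ζ + 2 * Real.pi * Complex.I) = g (z, ζ) + k * (2 * Real.pi * Complex.I) := by
    intro z ζ
    rw [← hk]
    have := h2 (z, ζ) trivial (0, 0) trivial
    simp only at this ⊢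
    linear_combination this
  refine ⟨g, k, hg, fun z ζ => hg2 (z, ζ), ?_⟩
  intro z ζ j
  induction j generalizing ζ with
  | zero => simp
  | succ i ih =>
    have : ζ + ((i + 1 : ℤ) : ℂ) * (2 * Real.pi * Complex.I) =
      (ζ + (i : ℤ) * (2 * Real.pi * Complex.I)) + 2 * Real.pi * Complex.I := by push_cast; ring
    rw [this, h3, ih]
    push_cast; ring
  | pred i ih =>
    have := h3 z (ζ + ((-(i:ℤ) - 1 : ℤ) : ℂ) * (2 * Real.pi * Complex.I))
    have e : ζ + ((-(i:ℤ) - 1 : ℤ) : ℂ) * (2 * Real.pi * Complex.I) + 2 * Real.pi * Complex.I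
      = ζ + ((-(i:ℤ) : ℤ) : ℂ) * (2 * Real.pi * Complex.I) := by push_cast; ring
    rw [e, ih] at this
    push_cast at this ⊢
    linear_combination -this

lemma bw_sq (G : ℂ ≃ₜ ℂ) : BwOP (G ∘ G) := by
  have hpi : (2 * Real.pi * Complex.I : ℂ) ≠ 0 := Complex.two_pi_I_ne_zero
  have hGc := G.continuous
  obtain ⟨g, k, hg, hg2, hgk⟩ := bw_lift G
  obtain ⟨g', k', hg', hg2', hgk'⟩ := bw_lift G.symm
  have hkk : k' * k = 1 := by
    have hcc : Continuous (fun ζ : ℂ => g' (G 0, g (0, ζ)) - ζ) := by fun_prop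
    have := bw_const isPreconnected_univ 1 hcc.continuousOn (by
      intro ζ _
      rw [Complex.exp_sub, hg2', hg2]
      simp) (0 + ((1:ℤ) : ℂ) * (2 * Real.pi * Complex.I)) trivial 0 trivial
    rw [hgk] at this
    have e : ((1 : ℤ) : ℂ) * (k * (2 * Real.pi * Complex.I)) = k * (2 * Real.pi * Complex.I) := by
      push_cast; ring
    rw [e, hgk'] at this
    have h2 : ((k' * k : ℤ) : ℂ) * (2 * Real.pi * Complex.I) = 1 * (2 * Real.pi * Complex.I) := by
      push_cast at this ⊢
      linear_combination this
    have h3 := mul_right_cancel₀ hpi h2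
    exact_mod_cast h3
  have hk2 : k * k = 1 := by
    have : IsUnit k := IsUnit.of_mul_eq_one k' (by rw [mul_comm]; exact hkk)
    rcases Int.isUnit_iff.1 this with h | h <;> simp [h]
  set M : ℂ × ℂ → ℂ := fun p => g (G p.1, g p) - p.2 with hM
  have hMc : Continuous M := by fun_prop
  have hMp : ∀ z a b, Complex.exp a = Complex.exp b → M (z, a) = M (z, b) := by
    intro z a b h
    obtain ⟨n, rfl⟩ := Complex.exp_eq_exp_iff_exists_int.1 h
    simp only [hM]
    have e : g (z, b) + (n : ℂ) * (k * (2 * Real.pi * Complex.I)) =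
      g (z, b) + ((n * k : ℤ) : ℂ) * (2 * Real.pi * Complex.I) := by push_cast; ring
    have hk2' : (k : ℂ) * k = 1 := by exact_mod_cast hk2
    rw [hgk, e, hgk]
    push_cast
    linear_combination (n : ℂ) * (2 * Real.pi * Complex.I) * hk2'
  refine ⟨fun p => M (p.1, Complex.log (p.2 - p.1)), ?_, ?_⟩
  · rintro ⟨z0, w0⟩ h0
    have h0' : w0 - z0 ≠ 0 := sub_ne_zero.2 (Ne.symm h0)
    apply ContinuousAt.continuousWithinAt
    by_cases hs : w0 - z0 ∈ Complex.slitPlane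
    · refine hMc.continuousAt.comp (ContinuousAt.prodMk continuousAt_fst ?_)
      exact ContinuousAt.clog (by fun_prop) hs
    · have hs' : -(w0 - z0) ∈ Complex.slitPlane := by
        rw [Complex.mem_slitPlane_iff] at hs ⊢
        push Not at hs
        left
        rcases hs.1.lt_or_eq with h | h
        · rw [Complex.neg_re]; linarith
        · exact absurd (Complex.ext h hs.2) h0'
      have h1 : ContinuousAt (fun p : ℂ × ℂ =>
          M (p.1, Complex.log (-(p.2 - p.1)) + Real.pi * Complex.I)) (z0, w0) := by
        refine hMc.continuousAt.comp (ContinuousAt.prodMk continuousAt_fst ?_)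
        have h2 : ContinuousAt (fun p : ℂ × ℂ => Complex.log (-(p.2 - p.1))) (z0, w0) :=
          ContinuousAt.clog (by fun_prop) hs'
        exact h2.add continuousAt_const
      refine h1.congr ?_
      have : ∀ᶠ p : ℂ × ℂ in 𝓝 (z0, w0), p.2 - p.1 ≠ 0 :=
        ContinuousAt.eventually_ne (g := fun p : ℂ × ℂ => p.2 - p.1) (by fun_prop) h0'
      filter_upwards [this] with p hp
      apply hMp
      rw [Complex.exp_log hp, Complex.exp_add, Complex.exp_log (neg_ne_zero.2 hp),
        Complex.exp_pi_mul_I]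
      ring
  · intro z w h
    have h0' : w - z ≠ 0 := sub_ne_zero.2 (Ne.symm h)
    simp only [hM]
    rw [Complex.exp_sub, hg2, hg2, Complex.exp_log h0']
    simp

lemma bw_push (a b : ℂ) (R : ℝ) (hab : ‖b - a‖ < R) : ∃ φ : ℂ ≃ₜ ℂ, BwOP φ ∧ φ a = b ∧
    ∀ z, R ≤ ‖z - a‖ → φ z = z := by
  have hR : 0 < R := (norm_nonneg _).trans_lt hab
  set ρ : ℂ → ℝ := fun z => max 0 (1 - ‖z - a‖ / R) with hρ
  have hρl : ∀ z w, |ρ z - ρ w| ≤ ‖z - w‖ / R := by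
    intro z w
    simp only [hρ]
    have h1 : |max 0 (1 - ‖z - a‖ / R) - max 0 (1 - ‖w - a‖ / R)| ≤
        |(1 - ‖z - a‖ / R) - (1 - ‖w - a‖ / R)| := by
      rw [max_comm 0, max_comm 0]
      exact abs_max_sub_max_le_abs _ _ _
    refine h1.trans ?_
    have h2 : (1 - ‖z - a‖ / R) - (1 - ‖w - a‖ / R) = (‖w - a‖ - ‖z - a‖) / R := by ring
    rw [h2, abs_div, abs_of_pos hR]
    gcongr
    refine (abs_norm_sub_norm_le _ _).trans ?_
    rw [sub_sub_sub_cancel_right, norm_sub_rev]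
  set c := ‖b - a‖ / R with hc
  have hc1 : c < 1 := (div_lt_one hR).2 hab
  have hc0 : 0 ≤ c := by positivity
  set φ : ℂ → ℂ := fun z => z + (ρ z : ℂ) * (b - a) with hφ
  have hφl : ∀ z w, ‖(φ z - φ w) - (z - w)‖ ≤ c * ‖z - w‖ := by
    intro z w
    have : (φ z - φ w) - (z - w) = ((ρ z - ρ w : ℝ) : ℂ) * (b - a) := by
      simp only [hφ]; push_cast; ring
    rw [this, norm_mul, Complex.norm_real, Real.norm_eq_abs]
    calc _ ≤ ‖z - w‖ / R * ‖b - a‖ := by gcongr; exact hρl z w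
      _ = c * ‖z - w‖ := by rw [hc]; ring
  have hA : ApproximatesLinearOn φ ((ContinuousLinearEquiv.refl ℝ ℂ : ℂ ≃L[ℝ] ℂ) : ℂ →L[ℝ] ℂ) univ
      ⟨c, hc0⟩ := by
    intro z _ w _
    exact hφl z w
  set Φ := hA.toHomeomorph φ (Or.inr (by
    have h1 : ‖((ContinuousLinearEquiv.refl ℝ ℂ).symm : ℂ →L[ℝ] ℂ)‖₊ = 1 := by
      apply NNReal.eq
      exact ContinuousLinearMap.norm_id
    rw [h1, inv_one]
    exact hc1)) with hΦ
  have hΦφ : ∀ z, Φ z = φ z := fun z => rfl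
  have hφc : Continuous φ := Φ.continuous
  have hq : ∀ z w, z ≠ w → ‖(φ w - φ z) / (w - z) - 1‖ < 1 := by
    intro z w h
    have h1 : w - z ≠ 0 := sub_ne_zero.2 (Ne.symm h)
    have e : (φ w - φ z) / (w - z) - 1 = ((φ w - φ z) - (w - z)) / (w - z) := by field_simp
    rw [e, norm_div, div_lt_one (norm_pos_iff.2 h1)]
    refine (hφl w z).trans_lt ?_
    have := norm_pos_iff.2 h1
    nlinarith
  have hsl : ∀ z w, z ≠ w → (φ w - φ z) / (w - z) ∈ Complex.slitPlane := by
    intro z w h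
    have := Complex.mem_slitPlane_of_norm_lt_one (hq z w h)
    simpa using this
  refine ⟨Φ, ⟨fun p => Complex.log ((φ p.2 - φ p.1) / (p.2 - p.1)), ?_, ?_⟩, ?_, ?_⟩
  · refine ContinuousOn.clog ?_ (fun p hp => hsl _ _ hp)
    refine ContinuousOn.div (Continuous.continuousOn (by fun_prop))
      (Continuous.continuousOn (by fun_prop)) ?_
    intro p hp
    exact sub_ne_zero.2 (Ne.symm hp)
  · intro z w h
    exact Complex.exp_log (Complex.slitPlane_ne_zero (hsl z w h))
  · rw [hΦφ]
    simp [hφ, hρ]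
  · intro z hz
    rw [hΦφ]
    have : ρ z = 0 := by
      simp only [hρ]
      apply max_eq_left
      have : 1 ≤ ‖z - a‖ / R := (one_le_div hR).2 hz
      linarith
    simp [hφ, this]

lemma bw_bounded (G : ℂ ≃ₜ ℂ) (S : Set ℂ) (hS : IsCompact S) (z0 : ℂ)
    (hz0 : ∀ n, G^[n] z0 ∈ S) : ∃ z, G (G z) = z := by
  by_contra hcon
  push Not at hcon
  set H : ℂ ≃ₜ ℂ := G.trans G with hH
  have hHG : (H : ℂ → ℂ) = G ∘ G := rfl
  have hOP : BwOP H := by rw [hHG]; exact bw_sq G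
  have hf : ∀ z, H z ≠ z := hcon
  have hHn : ∀ n, H^[n] z0 ∈ S := by
    intro n
    have : H^[n] = G^[2 * n] := by
      rw [Function.iterate_mul, hHG]; rfl
    rw [this]
    exact hz0 _
  obtain ⟨x, -, ψ, hψ, hlim⟩ := hS.tendsto_subseq hHn
  obtain ⟨ε, hε, hfree⟩ : ∃ ε > 0, ∀ z, ‖z - x‖ < ε → ¬ ‖H z - x‖ < ε := by
    have hd : 0 < ‖H x - x‖ := norm_pos_iff.2 (sub_ne_zero.2 (hf x))
    have hcont : ContinuousAt (fun z => ‖H z - x‖) x := by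
      have := H.continuous
      fun_prop
    have h1 : ∀ᶠ z in 𝓝 x, ‖H x - x‖ / 2 < ‖H z - x‖ :=
      hcont.eventually (lt_mem_nhds (by linarith))
    obtain ⟨δ, hδ, hδ2⟩ := Metric.eventually_nhds_iff.1 h1
    refine ⟨min δ (‖H x - x‖ / 2), lt_min hδ (by linarith), ?_⟩
    intro z hz hz2
    have h2 := hδ2 (y := z) (by rw [dist_eq_norm]; exact hz.trans_le (min_le_left _ _))
    exact absurd (hz2.trans_le (min_le_right _ _)) (not_lt.2 h2.le)
  obtain ⟨N, hN⟩ := Metric.tendsto_atTop.1 hlim (ε / 3) (by linarith)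
  have hN1 := hN N le_rfl
  have hN2 := hN (N + 1) (by omega)
  have hij : ψ N < ψ (N + 1) := hψ (by omega)
  simp only [Function.comp, dist_eq_norm] at hN1 hN2
  set z := H^[ψ N] z0 with hz
  have hex : ∃ n, 1 ≤ n ∧ ‖H^[n] z - z‖ < 2 * ε / 3 := by
    refine ⟨ψ (N + 1) - ψ N, by omega, ?_⟩
    rw [hz, ← Function.iterate_add_apply, Nat.sub_add_cancel hij.le]
    have : H^[ψ (N + 1)] z0 - H^[ψ N] z0 = (H^[ψ (N + 1)] z0 - x) - (z - x) := by rw [hz]; ring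
    rw [this]
    refine (norm_sub_le _ _).trans_lt ?_
    linarith
  classical
  set n := Nat.find hex with hn
  obtain ⟨hn1, hn2⟩ := Nat.find_spec hex
  have hmin : ∀ m, 1 ≤ m → m < n → 2 * ε / 3 ≤ ‖H^[m] z - z‖ := by
    intro m h1 h2
    have := Nat.find_min hex h2
    push Not at this
    exact this h1
  obtain ⟨φ, hφ, hφz, hφo⟩ := bw_push z (H^[n] z) (2 * ε / 3) hn2
  set H' : ℂ ≃ₜ ℂ := H.trans φ.symm with hH'
  have hH'a : ∀ p, H' p = φ.symm (H p) := fun p => rfl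
  have hOP' : BwOP H' := by
    have : (H' : ℂ → ℂ) = φ.symm ∘ H := rfl
    rw [this]
    exact hφ.symm.comp hOP H.injective H.continuous
  refine bw_no_periodic H' hOP' ?_ z n hn1 ?_
  · intro p hp
    rw [hH'a, Homeomorph.symm_apply_eq] at hp
    rcases le_or_gt (2 * ε / 3) ‖p - z‖ with h | h
    · rw [hφo p h] at hp
      exact hf p hp
    · have h2 : ‖φ p - z‖ < 2 * ε / 3 := by
        by_contra h3
        have h4 := φ.injective (hφo _ (not_lt.1 h3))
        rw [h4] at h3
        exact h3 h
      rw [← hp] at h2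
      have hb : ∀ q, ‖q - z‖ < 2 * ε / 3 → ‖q - x‖ < ε := by
        intro q hq
        have : q - x = (q - z) + (z - x) := by ring
        rw [this]
        refine (norm_add_le _ _).trans_lt ?_
        linarith
      exact hfree p (hb _ h) (hb _ h2)
  · have hit : ∀ m, m < n → H'^[m] z = H^[m] z := by
      intro m
      induction m with
      | zero => simp
      | succ m ih =>
        intro hm
        rw [Function.iterate_succ_apply', Function.iterate_succ_apply', ih (by omega), hH'a,
          Homeomorph.symm_apply_eq, hφo]
        have := hmin (m + 1) (by omega) hm
        rwa [Function.iterate_succ_apply'] at this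
    obtain ⟨m, hm⟩ : ∃ m, n = m + 1 := ⟨n - 1, by omega⟩
    rw [hm, Function.iterate_succ_apply', hit m (by omega), hH'a, Homeomorph.symm_apply_eq, hφz,
      hm, Function.iterate_succ_apply']

def bwIoo : Set.Ioo (0:ℝ) 1 ≃ₜ ℝ where
  toFun t := Real.log (t.1 / (1 - t.1))
  invFun s := ⟨Real.exp s / (1 + Real.exp s), by positivity, by
    rw [div_lt_one (by positivity)]; linarith⟩
  left_inv t := by
    have h1 : 0 < t.1 := t.2.1
    have h2 : 0 < 1 - t.1 := by linarith [t.2.2]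
    apply Subtype.ext
    simp only
    rw [Real.exp_log (by positivity)]
    field_simp
    ring
  right_inv s := by
    simp only
    have h : Real.exp s / (1 + Real.exp s) / (1 - Real.exp s / (1 + Real.exp s)) = Real.exp s := by
      have : (1 + Real.exp s) ≠ 0 := by positivity
      have h2 : 1 - Real.exp s / (1 + Real.exp s) = 1 / (1 + Real.exp s) := by field_simp; ring
      rw [h2]
      field_simp
    rw [h, Real.log_exp]
  continuous_toFun := by
    refine Continuous.log (Continuous.div (by fun_prop) (by fun_prop) ?_) ?_
    · intro t; have := t.2.2; linarith
    · intro t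
      have h1 : 0 < t.1 := t.2.1
      have h2 : 0 < 1 - t.1 := by linarith [t.2.2]
      positivity
  continuous_invFun := by
    refine Continuous.subtype_mk (Continuous.div (by fun_prop) (by fun_prop) ?_) _
    intro s; positivity

def bwE : AnnTil ≃ₜ ℂ :=
  ((Homeomorph.refl ℝ).prodCongr bwIoo).trans Complex.equivRealProdCLM.symm.toHomeomorph

instance : ContractibleSpace AnnTil := bwE.contractibleSpace

instance : LocallyPathConnectedSpace (Set.Ioo (0:ℝ) 1) := isOpen_Ioo.locallyPathConnectedSpace

lemma pr_continuous : Continuous pr := by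
  unfold pr; fun_prop

lemma pr_surjective : Function.Surjective pr := by
  rintro ⟨c, y⟩
  obtain ⟨t, rfl⟩ := Circle.exp_surjective c
  refine ⟨(t / (2 * Real.pi), y), ?_⟩
  have : 2 * Real.pi * (t / (2 * Real.pi)) = t := by field_simp
  simp [pr, this]

lemma pr_isOpenMap : IsOpenMap pr := by
  have h1 : IsOpenMap (fun x : ℝ => Circle.exp (2 * Real.pi * x)) :=
    isLocalHomeomorph_circleExp.isOpenMap.comp
      (Homeomorph.mulLeft₀ (2 * Real.pi) (by positivity)).isOpenMap
  exact h1.prodMap IsOpenMap.id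

lemma pr_isOpenQuotientMap : IsOpenQuotientMap pr :=
  ⟨pr_surjective, pr_continuous, pr_isOpenMap⟩

lemma pr_eq {z w : AnnTil} (h : pr z = pr w) : ∃ k : ℤ, z = tr w k := by
  simp only [pr, Prod.mk.injEq] at h
  obtain ⟨m, hm⟩ := Circle.exp_eq_exp.1 h.1
  refine ⟨m, Prod.ext ?_ h.2⟩
  have : 2 * Real.pi * z.1 = 2 * Real.pi * (w.1 + m) := by linarith
  exact mul_left_cancel₀ (by positivity) this

lemma pr_tr (z : AnnTil) (k : ℤ) : pr (tr z k) = pr z := by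
  simp only [pr, tr, Prod.mk.injEq, and_true]
  exact Circle.exp_eq_exp.2 ⟨k, by ring⟩

lemma pr_lift {q : AnnTil → Ann} (hq : Continuous q) (a e : AnnTil) (h : pr e = q a) :
    ∃ H : AnnTil → AnnTil, Continuous H ∧ H a = e ∧ pr ∘ H = q := by
  have hq1 : Continuous (fun z => (q z).1) := by fun_prop
  have hq2 : Continuous (fun z => (q z).2) := by fun_prop
  obtain ⟨L, ⟨hL1, hL2⟩, -⟩ := Circle.isCoveringMap_exp.existsUnique_continuousMap_lifts
    (⟨fun z => (q z).1, hq1⟩ : C(AnnTil, Circle)) a (2 * Real.pi * e.1) (by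
      change _ = (q a).1
      rw [← h]; rfl)
  have hLc := L.continuous
  refine ⟨fun z => (L z / (2 * Real.pi), (q z).2), by fun_prop, ?_, ?_⟩
  · refine Prod.ext ?_ ?_
    · simp only [hL1]; field_simp
    · simp only; rw [← h]; rfl
  · funext z
    have h1 : Circle.exp (L z) = (q z).1 := congrFun hL2 z
    have : 2 * Real.pi * (L z / (2 * Real.pi)) = L z := by field_simp
    refine Prod.ext ?_ rfl
    simp only [Function.comp, pr, this, h1]

lemma pr_unique {H1 H2 : AnnTil → AnnTil} (h1 : Continuous H1) (h2 : Continuous H2)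
    (h : pr ∘ H1 = pr ∘ H2) (a : AnnTil) (ha : H1 a = H2 a) : H1 = H2 := by
  have := Circle.isCoveringMap_exp.eq_of_comp_eq (g₁ := fun z => 2 * Real.pi * (H1 z).1)
    (g₂ := fun z => 2 * Real.pi * (H2 z).1) (by fun_prop) (by fun_prop)
    (by funext z; exact congrArg Prod.fst (congrFun h z)) a (by simp only [ha])
  funext z
  refine Prod.ext ?_ (congrArg Prod.snd (congrFun h z) :)
  exact mul_left_cancel₀ (by positivity) (congrFun this z)

/-- A lift of a covering map is a homeomorphism. -/
lemma lift_homeo {f : Ann → Ann} (hcov : IsCoveringMap f) {F : AnnTil → AnnTil}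
    (hF : IsLift f F) : ∃ G : AnnTil ≃ₜ AnnTil, ∀ z, G z = F z := by
  obtain ⟨hFc, hFl⟩ := hF
  set z0 : AnnTil := (0, ⟨1 / 2, by norm_num, by norm_num⟩) with hz0
  obtain ⟨h, ⟨h1, h2⟩, -⟩ := hcov.existsUnique_continuousMap_lifts
    (⟨pr, pr_continuous⟩ : C(AnnTil, Ann)) (F z0) (pr z0) (congrFun hFl z0).symm
  have h2' : f ∘ h = pr := h2
  obtain ⟨H, hHc, hH0, hH⟩ := pr_lift h.continuous (F z0) z0 h1.symm
  have hFH : F ∘ H = id := by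
    refine pr_unique (hFc.comp hHc) continuous_id ?_ (F z0) (by simp [hH0])
    rw [← Function.comp_assoc, hFl, Function.comp_assoc, hH, h2']; rfl
  have hpr : pr ∘ (H ∘ F) = pr := by
    refine hcov.eq_of_comp_eq (pr_continuous.comp (hHc.comp hFc)) pr_continuous ?_ z0
      (by simp [hH0])
    rw [← Function.comp_assoc pr, hH, ← Function.comp_assoc, h2', hFl]
  have hHF : H ∘ F = id :=
    pr_unique (hHc.comp hFc) continuous_id (by rw [hpr]; rfl) z0 (by simp [hH0])
  exact ⟨⟨⟨F, H, congrFun hHF, congrFun hFH⟩, hFc, hHc⟩, fun z => rfl⟩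

/-- A lift homeomorphism with a bounded orbit gives a periodic point. -/
lemma ann_periodic {f : Ann → Ann} (G : AnnTil ≃ₜ AnnTil) (hG : ∀ z, pr (G z) = f (pr z))
    (S : Set AnnTil) (hS : IsCompact S) (z0 : AnnTil) (h : ∀ n, G^[n] z0 ∈ S) :
    ∃ (x : Ann) (n : ℕ), 1 ≤ n ∧ f^[n] x = x := by
  set T : ℂ ≃ₜ ℂ := (bwE.symm.trans G).trans bwE with hT
  have hTa : ∀ z, T z = bwE (G (bwE.symm z)) := fun z => rfl
  obtain ⟨z, hz⟩ := bw_bounded T (bwE '' S) (hS.image bwE.continuous) (bwE z0) (by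
    intro n
    have : T^[n] (bwE z0) = bwE (G^[n] z0) := by
      induction n with
      | zero => rfl
      | succ n ih => rw [Function.iterate_succ_apply', ih, hTa, Function.iterate_succ_apply']; simp
    rw [this]
    exact ⟨_, h n, rfl⟩)
  refine ⟨pr (bwE.symm z), 2, by norm_num, ?_⟩
  change f (f (pr (bwE.symm z))) = _
  rw [← hG, ← hG]
  congr 1
  rw [hTa, hTa] at hz
  apply bwE.injective
  simpa using hz

/-- A degree-`d` (`|d|>1`) covering map of the annulus preserving a continuum
has a periodic point. -/
theorem stmt_19 (f : Ann → Ann) (d : ℤ) (hcov : IsCoveringMap f)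
    (hdeg : HasDegree f d) (hd : 1 < |d|)
    (K : Set Ann) (hKc : IsCompact K) (hKconn : IsConnected K)
    (hKinv : f '' K ⊆ K) :
    ∃ (x : Ann) (n : ℕ), 1 ≤ n ∧ f^[n] x = x := by
  obtain ⟨F, hF, hFd⟩ := hdeg
  have hFc := hF.1
  have hfc : Continuous f := hcov.continuous
  have hFl : ∀ z, pr (F z) = f (pr z) := congrFun hF.2
  have hpi := Real.pi_pos
  have hdR : (1:ℝ) < |(d:ℝ)| := by exact_mod_cast hd
  have hd0 : (d:ℝ) ≠ 0 := by
    intro h; rw [h] at hdR; norm_num at hdR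
  have hFk : ∀ (k : ℤ) z, (F (tr z k)).1 = (F z).1 + d * k := by
    have h1 : ∀ z, (F (tr z 1)).1 = (F z).1 + d := fun z => by rw [hFd]; rfl
    have htr : ∀ z (a b : ℤ), tr (tr z a) b = tr z (a + b) := by
      intro z a b
      simp [tr, add_assoc]
    intro k
    induction k with
    | zero => intro z; simp [tr]
    | succ i ih =>
      intro z
      rw [← htr, h1, ih]; push_cast; ring
    | pred i ih =>
      intro z
      have := h1 (tr z (-(i:ℤ) - 1))
      rw [htr, sub_add_cancel, ih] at this
      push_cast at this ⊢
      linarith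
  -- displacement
  obtain ⟨ψ, hψc, hψ⟩ : ∃ ψ : Ann → ℝ, Continuous ψ ∧ ∀ z, ψ (pr z) = (F z).1 - d * z.1 := by
    set ψ : Ann → ℝ := fun p => (F (Function.surjInv pr_surjective p)).1 -
      d * (Function.surjInv pr_surjective p).1 with hψ
    have h : ∀ z, ψ (pr z) = (F z).1 - d * z.1 := by
      intro z
      obtain ⟨k, hk⟩ := pr_eq (Function.surjInv_eq pr_surjective (pr z))
      simp only [hψ]
      rw [hk, hFk]
      simp only [tr]
      ring
    refine ⟨ψ, ?_, h⟩
    rw [← pr_isOpenQuotientMap.continuous_comp_iff]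
    have : ψ ∘ pr = fun z => (F z).1 - d * z.1 := funext h
    rw [this]
    fun_prop
  have hKit : ∀ p ∈ K, ∀ n, f^[n] p ∈ K := by
    intro p hp n
    induction n with
    | zero => exact hp
    | succ n ih => rw [Function.iterate_succ_apply']; exact hKinv ⟨_, ih, rfl⟩
  have hfK : ∀ p ∈ K, f p ∈ K := fun p hp => hKinv ⟨p, hp, rfl⟩
  obtain ⟨M, hM⟩ := hKc.exists_bound_of_continuousOn hψc.continuousOn
  set u : ℕ → ℝ := fun n => M * |(d:ℝ)|⁻¹ * |(d:ℝ)|⁻¹ ^ n with hu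
  have hus : Summable u := by
    refine Summable.mul_left _ (summable_geometric_of_lt_one (by positivity) ?_)
    exact inv_lt_one_of_one_lt₀ hdR
  have hbd : ∀ n p, p ∈ K → ‖ψ (f^[n] p) / (d:ℝ) ^ (n + 1)‖ ≤ u n := by
    intro n p hp
    have h1 := hM _ (hKit p hp n)
    rw [norm_div, norm_pow, Real.norm_eq_abs (d:ℝ)]
    have h2 : u n = M / |(d:ℝ)| ^ (n + 1) := by
      simp only [hu]
      rw [inv_pow, pow_succ, div_eq_mul_inv, mul_inv]
      ring
    rw [h2]
    gcongr
  set η : Ann → ℝ := fun p => ∑' n : ℕ, ψ (f^[n] p) / (d:ℝ) ^ (n + 1) with hη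
  have hηc : ContinuousOn η K := by
    refine continuousOn_tsum (fun n => Continuous.continuousOn ?_) hus hbd
    have := hfc.iterate n
    fun_prop
  have hηf : ∀ p ∈ K, (d:ℝ) * η p = ψ p + η (f p) := by
    intro p hp
    have hs : Summable (fun n : ℕ => ψ (f^[n] p) / (d:ℝ) ^ (n + 1)) :=
      Summable.of_norm_bounded hus (fun n => hbd n p hp)
    have h1 : η p = ψ p / d + ∑' n : ℕ, ψ (f^[n + 1] p) / (d:ℝ) ^ (n + 1 + 1) := by
      simp only [hη]
      rw [hs.tsum_eq_zero_add]
      simp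
    have h2 : ∑' n : ℕ, ψ (f^[n + 1] p) / (d:ℝ) ^ (n + 1 + 1) = η (f p) / d := by
      simp only [hη]
      rw [← tsum_div_const]
      refine tsum_congr fun n => ?_
      rw [Function.iterate_succ_apply, pow_succ (d:ℝ) (n + 1)]
      field_simp
    rw [h1, h2]
    field_simp
  set h : AnnTil → ℝ := fun z => z.1 + η (pr z) with hh
  have hhF : ∀ z, pr z ∈ K → h (F z) = d * h z := by
    intro z hz
    simp only [hh]
    rw [hFl, mul_add, hηf _ hz, hψ]
    ring
  -- the key point
  obtain ⟨z0, hz0, m, hm⟩ : ∃ z0, pr z0 ∈ K ∧ ∃ m : ℤ, (d:ℝ) * h z0 = h z0 + m := by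
    by_contra hcon
    push Not at hcon
    set W : Ann → ℂ := fun p => -((p.1 : ℂ) * Complex.exp ((2 * Real.pi * η p : ℝ) * Complex.I))
      with hW
    have hWh : ∀ z, W (pr z) = - Complex.exp ((2 * Real.pi * h z : ℝ) * Complex.I) := by
      intro z
      simp only [hW, hh, pr, Circle.coe_exp]
      rw [← Complex.exp_add]
      push_cast
      ring_nf
    have hWn : ∀ p, ‖W p‖ = 1 := by
      intro p
      simp only [hW]
      rw [norm_neg, norm_mul, Complex.norm_exp_ofReal_mul_I, Circle.norm_coe, mul_one]
    have hWs : ∀ p ∈ K, W p ∈ Complex.slitPlane := by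
      intro p hp
      obtain ⟨z, rfl⟩ := pr_surjective p
      by_contra hs
      rw [Complex.mem_slitPlane_iff] at hs
      push Not at hs
      have h1 : W (pr z) = -1 := by
        have h2 : W (pr z) = ((W (pr z)).re : ℂ) := Complex.ext (by simp) (by simp [hs.2])
        have h3 := hWn (pr z)
        rw [h2, Complex.norm_real, Real.norm_eq_abs, abs_of_nonpos hs.1] at h3
        rw [h2, show (W (pr z)).re = -1 by linarith]
        simp
      rw [hWh, neg_inj, Complex.exp_eq_one_iff] at h1
      obtain ⟨n, hn⟩ := h1
      have h2 : ((2 * Real.pi * h z : ℝ) : ℂ) = ((n * (2 * Real.pi) : ℝ) : ℂ) := by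
        apply mul_right_cancel₀ Complex.I_ne_zero
        rw [hn]; push_cast; ring
      have h3 : 2 * Real.pi * h z = n * (2 * Real.pi) := by exact_mod_cast h2
      have h4 : h z = n := by
        apply mul_left_cancel₀ (show (2 * Real.pi) ≠ 0 by positivity)
        linarith
      refine hcon z hp ((d - 1) * n) ?_
      rw [h4]; push_cast; ring
    set g : Ann → ℝ := fun p => Complex.arg (W p) / (2 * Real.pi) + 1 / 2 with hg
    have hWc : ContinuousOn W K := by
      have h1 : Continuous (fun p : Ann => (p.1 : ℂ)) := by fun_prop
      have h2 : ContinuousOn (fun p : Ann =>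
          Complex.exp ((2 * Real.pi * η p : ℝ) * Complex.I)) K := by fun_prop
      exact (h1.continuousOn.mul h2).neg
    have hgc : ContinuousOn g K := by
      have : ContinuousOn (fun p => Complex.arg (W p)) K := by
        intro p hp
        exact (Complex.continuousAt_arg (hWs p hp)).comp_continuousWithinAt (hWc p hp)
      fun_prop
    have hgh : ∀ z, ∃ n : ℤ, h z = g (pr z) + n := by
      intro z
      have h1 := Complex.norm_mul_exp_arg_mul_I (W (pr z))
      rw [hWn, Complex.ofReal_one, one_mul] at h1
      have h2 : Complex.exp ((2 * Real.pi * h z : ℝ) * Complex.I) =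
          Complex.exp ((Complex.arg (W (pr z)) : ℂ) * Complex.I + Real.pi * Complex.I) := by
        rw [Complex.exp_add, h1, Complex.exp_pi_mul_I, hWh]; ring
      obtain ⟨n, hn⟩ := Complex.exp_eq_exp_iff_exists_int.1 h2
      refine ⟨n, ?_⟩
      have h3 : ((2 * Real.pi * h z : ℝ) : ℂ) =
          ((Complex.arg (W (pr z)) + Real.pi + n * (2 * Real.pi) : ℝ) : ℂ) := by
        apply mul_right_cancel₀ Complex.I_ne_zero
        rw [hn]; push_cast; ring
      have h4 : 2 * Real.pi * h z = Complex.arg (W (pr z)) + Real.pi + n * (2 * Real.pi) := by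
        exact_mod_cast h3
      simp only [hg]
      field_simp
      linarith
    have hinteg : ∀ p ∈ K, ∃ n : ℤ, d * g p - g (f p) = n := by
      intro p hp
      obtain ⟨z, rfl⟩ := pr_surjective p
      obtain ⟨n, hn⟩ := hgh z
      obtain ⟨n', hn'⟩ := hgh (F z)
      rw [hhF z hp, hFl, hn] at hn'
      refine ⟨n' - d * n, ?_⟩
      push_cast
      linarith
    have hconst : ∀ p ∈ K, ∀ q ∈ K, d * g p - g (f p) = d * g q - g (f q) := by
      have hcc : ContinuousOn (fun p => ((d * g p - g (f p) : ℝ) : ℂ) * (2 * Real.pi * Complex.I))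
          K := by
        have h1 : ContinuousOn (fun p => g (f p)) K := hgc.comp hfc.continuousOn hfK
        have h2 : ContinuousOn (fun p => (d:ℝ) * g p - g (f p)) K :=
          (continuousOn_const.mul hgc).sub h1
        exact (Complex.continuous_ofReal.comp_continuousOn h2).mul continuousOn_const
      have := bw_const hKconn.isPreconnected 1 hcc (by
        intro p hp
        obtain ⟨n, hn⟩ := hinteg p hp
        rw [hn, Complex.exp_eq_one_iff]
        exact ⟨n, by push_cast; ring⟩)
      intro p hp q hq
      have h1 := mul_right_cancel₀ Complex.two_pi_I_ne_zero (this p hp q hq)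
      exact_mod_cast h1
    obtain ⟨p, hp, hpm⟩ := hKc.exists_isMaxOn hKconn.nonempty hgc
    obtain ⟨q, hq, hqm⟩ := hKc.exists_isMinOn hKconn.nonempty hgc
    have hpm' : ∀ x ∈ K, g x ≤ g p := fun x hx => hpm hx
    have hqm' : ∀ x ∈ K, g q ≤ g x := fun x hx => hqm hx
    have h1 : (d:ℝ) * (g p - g q) = g (f p) - g (f q) := by
      have := hconst p hp q hq
      linarith
    have h2 : |(d:ℝ)| * (g p - g q) ≤ g p - g q := by
      have h3 : |(d:ℝ) * (g p - g q)| ≤ g p - g q := by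
        rw [h1, abs_le]
        have := hpm' _ (hfK p hp)
        have := hpm' _ (hfK q hq)
        have := hqm' _ (hfK p hp)
        have := hqm' _ (hfK q hq)
        constructor <;> linarith
      rwa [abs_mul, abs_of_nonneg (sub_nonneg.2 (hqm' p hp))] at h3
    have h3 : g p = g q := by
      have := hqm' p hp
      nlinarith
    have h4 : g (f p) = g p := by
      have := hpm' _ (hfK p hp)
      have := hqm' _ (hfK p hp)
      linarith
    obtain ⟨n, hn⟩ := hinteg p hp
    obtain ⟨z, rfl⟩ := pr_surjective p
    obtain ⟨n', hn'⟩ := hgh z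
    refine hcon z hp (n + (d - 1) * n') ?_
    rw [hn']
    push_cast
    rw [h4] at hn
    linear_combination hn
  -- the right lift
  obtain ⟨G0, hG0⟩ := lift_homeo hcov hF
  set G : AnnTil ≃ₜ AnnTil := G0.trans
    ((Homeomorph.addRight (-(m:ℝ))).prodCongr (Homeomorph.refl _)) with hG
  have hGa : ∀ z, G z = tr (F z) (-m) := by
    intro z
    rw [← hG0]
    refine Prod.ext ?_ rfl
    simp [hG, tr]
  have hGl : ∀ z, pr (G z) = f (pr z) := by
    intro z
    rw [hGa, pr_tr, hFl]
  have horb : ∀ n, pr (G^[n] z0) ∈ K ∧ h (G^[n] z0) = h z0 := by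
    intro n
    induction n with
    | zero => exact ⟨hz0, rfl⟩
    | succ n ih =>
      rw [Function.iterate_succ_apply']
      refine ⟨by rw [hGl]; exact hfK _ ih.1, ?_⟩
      have h1 := hhF _ ih.1
      rw [ih.2, hm] at h1
      rw [hGa]
      simp only [hh] at h1 ⊢
      rw [pr_tr]
      simp only [tr]
      push_cast
      linarith
  obtain ⟨C, hC⟩ := hKc.exists_bound_of_continuousOn hηc
  refine ann_periodic G hGl (Icc (h z0 - C) (h z0 + C) ×ˢ (Prod.snd '' K))
    (isCompact_Icc.prod (hKc.image continuous_snd)) z0 ?_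
  intro n
  obtain ⟨h1, h2⟩ := horb n
  have h3 := abs_le.1 (hC _ h1)
  have h4 : (G^[n] z0).1 + η (pr (G^[n] z0)) = h z0 := h2
  exact ⟨⟨by linarith [h3.2], by linarith [h3.1]⟩, ⟨_, h1, rfl⟩⟩
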